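/- arXiv:1605.03890 — 13 statements merged into one kernel-verified Lean document; each statement's English description precedes it below -/
import Mathlib

section
/- Let ω, L, C be positive reals, Z_C = 1/(iωC), Z_L = iωL, and Ω = ω²LC. If 9(4−√15) < 2Ω < 9(4+√15), then the complex number Z = (1/(10ωC))·((9+2Ω)·i + √(144Ω − 4Ω² − 81)) (with the real square root, whose argument is positive under the stated condition) satisfies Re(Z) > 0, Z ≠ 0, Z_L ≠ 0, 3Z_C + 5Z/3 ≠ 0, and the characteristic impedance equation 1/Z = 1/Z_L + 1/(3Z_C + 5Z/3). -/
/-- Feynman–Sierpinski Ladder: under the filter condition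
`9(4−√15) < 2ω²LC < 9(4+√15)`, the stated `Z` has positive real part and
satisfies the characteristic impedance equation `1/Z = 1/Z_L + 1/(3Z_C + 5Z/3)`. -/
theorem fsl_filter_impedance (ω L C : ℝ) (hω : 0 < ω) (hL : 0 < L) (hC : 0 < C)
    (Z_C Z_L Z : ℂ) (Ω : ℝ)
    (hZC : Z_C = 1 / (Complex.I * (ω : ℂ) * (C : ℂ)))
    (hZL : Z_L = Complex.I * (ω : ℂ) * (L : ℂ))
    (hΩ : Ω = ω ^ 2 * L * C)
    (hfilter1 : 9 * (4 - Real.sqrt 15) < 2 * Ω)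
    (hfilter2 : 2 * Ω < 9 * (4 + Real.sqrt 15))
    (hZ : Z = ((1 / (10 * ω * C) : ℝ) : ℂ) *
      (((9 + 2 * Ω : ℝ) : ℂ) * Complex.I +
        ((Real.sqrt (144 * Ω - 4 * Ω ^ 2 - 81) : ℝ) : ℂ))) :
    0 < Z.re ∧ Z ≠ 0 ∧ Z_L ≠ 0 ∧ 3 * Z_C + 5 * Z / 3 ≠ 0 ∧
      1 / Z = 1 / Z_L + 1 / (3 * Z_C + 5 * Z / 3) := by
  have h15 : Real.sqrt 15 ^ 2 = 15 := Real.sq_sqrt (by norm_num)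
  have hD : 0 < 144 * Ω - 4 * Ω ^ 2 - 81 := by
    nlinarith [mul_pos (sub_pos.2 hfilter1) (sub_pos.2 hfilter2)]
  have hs : 0 < Real.sqrt (144 * Ω - 4 * Ω ^ 2 - 81) := Real.sqrt_pos.2 hD
  have hs2 := Real.sq_sqrt hD.le
  set s := Real.sqrt (144 * Ω - 4 * Ω ^ 2 - 81)
  have hsC : (s : ℂ) ^ 2 = 144 * Ω - 4 * Ω ^ 2 - 81 := by exact_mod_cast hs2
  have hωC : (ω : ℂ) ≠ 0 := by exact_mod_cast hω.ne'
  have hLC : (L : ℂ) ≠ 0 := by exact_mod_cast hL.ne'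
  have hCC : (C : ℂ) ≠ 0 := by exact_mod_cast hC.ne'
  have hΩC : (Ω : ℂ) = ω ^ 2 * L * C := by exact_mod_cast hΩ
  have hI := Complex.I_sq
  have hre : Z.re = 1 / (10 * ω * C) * s := by
    rw [hZ, Complex.re_ofReal_mul]
    simp
  have hpos : 0 < Z.re := by rw [hre]; positivity
  have hZ0 : Z ≠ 0 := fun h => by simp [h] at hpos
  have hZL0 : Z_L ≠ 0 := by
    rw [hZL]
    exact mul_ne_zero (mul_ne_zero Complex.I_ne_zero hωC) hLC
  have hZC' : Z_C = ((-(1 / (ω * C)) : ℝ) : ℂ) * Complex.I := by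
    rw [hZC]
    push_cast
    field_simp
    linear_combination hI
  have hWre : (3 * Z_C + 5 * Z / 3).re = 5 / 3 * Z.re := by
    have h : 3 * Z_C + 5 * Z / 3 =
        ((-(3 / (ω * C)) : ℝ) : ℂ) * Complex.I + ((5 / 3 : ℝ) : ℂ) * Z := by
      rw [hZC']
      push_cast
      ring
    rw [h, Complex.add_re, Complex.re_ofReal_mul, Complex.re_ofReal_mul]
    simp
  have hW0 : 3 * Z_C + 5 * Z / 3 ≠ 0 := fun h => by
    rw [h, Complex.zero_re] at hWre
    linarith
  refine ⟨hpos, hZ0, hZL0, hW0, ?_⟩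
  have hZmul : 10 * (ω * C * Z) = (9 + 2 * Ω) * Complex.I + s := by
    rw [hZ]
    push_cast
    field_simp
  have hZCmul : ω * C * Z_C = -Complex.I := by
    rw [hZC']
    push_cast
    field_simp
  have hZLmul : ω * C * Z_L = Ω * Complex.I := by
    rw [hZL, hΩC]
    ring
  have key : (3 * Z_C + 5 * Z / 3) * Z_L = Z * (Z_L + (3 * Z_C + 5 * Z / 3)) := by
    have hk : ((ω : ℂ) * C) ^ 2 ≠ 0 := pow_ne_zero 2 (mul_ne_zero hωC hCC)
    refine mul_left_cancel₀ hk ?_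
    have hz : (ω : ℂ) * C * Z = ((9 + 2 * Ω) * Complex.I + s) / 10 := by
      linear_combination hZmul / 10
    calc ((ω : ℂ) * C) ^ 2 * ((3 * Z_C + 5 * Z / 3) * Z_L)
        = (3 * (ω * C * Z_C) + 5 * (ω * C * Z) / 3) * (ω * C * Z_L) := by ring
      _ = (ω * C * Z) * (ω * C * Z_L + (3 * (ω * C * Z_C) + 5 * (ω * C * Z) / 3)) := by
        rw [hz, hZCmul, hZLmul]
        linear_combination (-1 / 60 : ℂ) * hsC + ((9 + 2 * Ω) ^ 2 / 60 - 3 * Ω : ℂ) * hI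
      _ = ((ω : ℂ) * C) ^ 2 * (Z * (Z_L + (3 * Z_C + 5 * Z / 3))) := by ring
  generalize 3 * Z_C + 5 * Z / 3 = W at hW0 key
  field_simp
  linear_combination key
end

section
/- Let ω, L, C be positive reals, Z_C = 1/(iωC), Z_L = iωL, and Ω = ω²LC. If 2Ω ≤ 9(4−√15) or 2Ω ≥ 9(4+√15), then every Z ∈ ℂ with Z ≠ 0 and 3Z_C + 5Z/3 ≠ 0 that satisfies 1/Z = 1/Z_L + 1/(3Z_C + 5Z/3) is purely imaginary, i.e. Re(Z) = 0. -/
/-- Feynman–Sierpinski Ladder: outside the filter frequency range, any solution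
of the characteristic impedance equation is purely imaginary. -/
theorem fsl_not_filter_outside_range (ω L C : ℝ) (hω : 0 < ω) (hL : 0 < L) (hC : 0 < C)
    (Z_C Z_L : ℂ) (Ω : ℝ)
    (hZC : Z_C = 1 / (Complex.I * (ω : ℂ) * (C : ℂ)))
    (hZL : Z_L = Complex.I * (ω : ℂ) * (L : ℂ))
    (hΩ : Ω = ω ^ 2 * L * C)
    (hout : 2 * Ω ≤ 9 * (4 - Real.sqrt 15) ∨ 9 * (4 + Real.sqrt 15) ≤ 2 * Ω) :
    ∀ Z : ℂ, Z ≠ 0 → 3 * Z_C + 5 * Z / 3 ≠ 0 →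
      1 / Z = 1 / Z_L + 1 / (3 * Z_C + 5 * Z / 3) → Z.re = 0 := by
  intro Z hZ hW hEq
  have hωc : (ω : ℂ) ≠ 0 := by exact_mod_cast hω.ne'
  have hLc : (L : ℂ) ≠ 0 := by exact_mod_cast hL.ne'
  have hCc : (C : ℂ) ≠ 0 := by exact_mod_cast hC.ne'
  have hI := Complex.I_ne_zero
  have hI2 := Complex.I_mul_I
  have hZL0 : Z_L ≠ 0 := by
    rw [hZL]
    exact mul_ne_zero (mul_ne_zero hI hωc) hLc
  have hZC' : Z_C * (ω * C) = -Complex.I := by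
    rw [hZC]
    field_simp
    rw [Complex.I_sq]
    ring
  have hcross : Z_L * (3 * Z_C + 5 * Z / 3) =
      Z * (3 * Z_C + 5 * Z / 3) + Z * Z_L := by
    generalize 3 * Z_C + 5 * Z / 3 = W at hW hEq ⊢
    field_simp at hEq
    linear_combination hEq
  have hquad : 5 * (ω * C : ℂ) * Z ^ 2 - (9 + 2 * (ω ^ 2 * L * C)) * Complex.I * Z
      - 9 * (ω * L) = 0 := by
    rw [hZL] at hcross
    linear_combination (-3 * (ω * C : ℂ)) * hcross
      + (9 * (Complex.I * ω * L) - 9 * Z) * hZC' - 9 * (ω * L : ℂ) * hI2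
  have hre := congrArg Complex.re hquad
  have him := congrArg Complex.im hquad
  simp [pow_two] at hre him
  have hdisc : 0 ≤ (9 + 2 * Ω) ^ 2 - 180 * Ω := by
    have hs := Real.sq_sqrt (show (0 : ℝ) ≤ 15 by norm_num)
    have hs0 := Real.sqrt_nonneg 15
    rcases hout with h | h
    · nlinarith [mul_nonneg (sub_nonneg.2 h)
        (show 0 ≤ 9 * (4 + Real.sqrt 15) - 2 * Ω by linarith)]
    · nlinarith [mul_nonneg (sub_nonneg.2 h)
        (show 0 ≤ 2 * Ω - 9 * (4 - Real.sqrt 15) by linarith)]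
  by_contra ha
  have hb : 10 * (ω * C) * Z.im = 9 + 2 * Ω := by
    apply mul_left_cancel₀ ha
    rw [hΩ]
    linear_combination him
  have hsum : 100 * (ω * C * Z.re) ^ 2 + ((9 + 2 * Ω) ^ 2 - 180 * Ω) = 0 := by
    have hre' : 5 * (ω * C) * (Z.re ^ 2 - Z.im ^ 2) + (9 + 2 * Ω) * Z.im - 9 * (ω * L) = 0 := by
      rw [hΩ]
      linear_combination hre
    linear_combination 20 * (ω * C) * hre' + (10 * (ω * C) * Z.im - (9 + 2 * Ω)) * hb
      - 180 * hΩ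
  have hpos : 0 < (ω * C * Z.re) ^ 2 := by positivity
  linarith
end

section
/- Let ω, L, C be positive reals, Z_C = 1/(iωC), Z_L = iωL, and Ω = ω²LC. (a) If 2Ω < 9(4−√15), then Z = (i/(10ωC))·(2Ω + 9 − √(4Ω² + 81 − 144Ω)) is nonzero, satisfies 3Z_C + 5Z/3 ≠ 0, and solves 1/Z = 1/Z_L + 1/(3Z_C + 5Z/3). (b) If 2Ω > 9(4+√15), then the same holds for Z = (i/(10ωC))·(2Ω + 9 + √(4Ω² + 81 − 144Ω)). In both cases Z is purely imaginary (the square roots are real since 4Ω² + 81 − 144Ω > 0 in both regimes). -/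
/-- Either root of the quadratic `5x² - (2Ω + 9)x + 9Ω = 0`, scaled by `i/(ωC)`, solves the
characteristic impedance equation of the ladder. -/
theorem fsl_impedance_of_sq_eq_discrim {ω L C s Ω : ℝ} (hω : 0 < ω) (hL : 0 < L) (hC : 0 < C)
    {Z_C Z_L Z : ℂ}
    (hZC : Z_C = 1 / (Complex.I * (ω : ℂ) * (C : ℂ)))
    (hZL : Z_L = Complex.I * (ω : ℂ) * (L : ℂ))
    (hΩ : Ω = ω ^ 2 * L * C) (hs : s ^ 2 = 4 * Ω ^ 2 + 81 - 144 * Ω)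
    (hZ : Z = Complex.I / ((10 * ω * C : ℝ) : ℂ) * ((2 * Ω + 9 + s : ℝ) : ℂ)) :
    Z ≠ 0 ∧ 3 * Z_C + 5 * Z / 3 ≠ 0 ∧
      1 / Z = 1 / Z_L + 1 / (3 * Z_C + 5 * Z / 3) ∧ Z.re = 0 := by
  have hΩ0 : 0 < Ω := by rw [hΩ]; positivity
  obtain ⟨x, hx⟩ : ∃ x : ℝ, x = (2 * Ω + 9 + s) / 10 := ⟨_, rfl⟩
  have hq : 5 * x ^ 2 - (2 * Ω + 9) * x + 9 * Ω = 0 := by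
    rw [hx]; linear_combination hs / 20
  have hx0 : x ≠ 0 := by
    rintro rfl; linarith
  have hy0 : 5 * x - 9 ≠ 0 := by
    intro h
    have h' : x = 9 / 5 := by linarith
    rw [h'] at hq; linarith
  have hωc : (ω : ℂ) ≠ 0 := by exact_mod_cast hω.ne'
  have hCc : (C : ℂ) ≠ 0 := by exact_mod_cast hC.ne'
  have hΩc : (Ω : ℂ) ≠ 0 := by exact_mod_cast hΩ0.ne'
  have hxc : (x : ℂ) ≠ 0 := by exact_mod_cast hx0
  have hyc : (5 * x - 9 : ℂ) ≠ 0 := by exact_mod_cast hy0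
  have hqc : (5 * x ^ 2 - (2 * Ω + 9) * x + 9 * Ω : ℂ) = 0 := by exact_mod_cast hq
  obtain ⟨a, ha⟩ : ∃ a : ℂ, a = Complex.I / (ω * C) := ⟨_, rfl⟩
  have ha0 : a ≠ 0 := by
    rw [ha]; exact div_ne_zero Complex.I_ne_zero (mul_ne_zero hωc hCc)
  have hZa : Z = a * x := by
    rw [hZ, ha, hx]; push_cast; field_simp
  have hZCa : Z_C = -a := by
    rw [hZC, ha, mul_assoc, one_div, mul_inv, Complex.inv_I]; ring
  have hZLa : Z_L = a * Ω := by
    rw [hZL, ha, hΩ]; push_cast; field_simp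
  have hsum : 3 * Z_C + 5 * Z / 3 = a * (5 * x - 9) / 3 := by
    rw [hZCa, hZa]; ring
  refine ⟨?_, ?_, ?_, ?_⟩
  · rw [hZa]; exact mul_ne_zero ha0 hxc
  · rw [hsum]; exact div_ne_zero (mul_ne_zero ha0 hyc) (by norm_num)
  · rw [hsum, hZa, hZLa]
    have h3 : a * (5 * x - 9) / 3 ≠ 0 := div_ne_zero (mul_ne_zero ha0 hyc) (by norm_num)
    rw [div_add_div _ _ (mul_ne_zero ha0 hΩc) h3,
      div_eq_div_iff (mul_ne_zero ha0 hxc) (mul_ne_zero (mul_ne_zero ha0 hΩc) h3)]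
    linear_combination a ^ 2 * (-hqc) / 3
  · rw [hZ, Complex.re_mul_ofReal, Complex.div_ofReal_re, Complex.I_re, zero_div, zero_mul]

/-- Feynman–Sierpinski Ladder: outside the filter range, the displayed purely
imaginary `Z` solves the characteristic impedance equation, with the branch
depending on the regime. -/
theorem fsl_impedance_outside_range (ω L C : ℝ) (hω : 0 < ω) (hL : 0 < L) (hC : 0 < C)
    (Z_C Z_L : ℂ) (Ω : ℝ)
    (hZC : Z_C = 1 / (Complex.I * (ω : ℂ) * (C : ℂ)))
    (hZL : Z_L = Complex.I * (ω : ℂ) * (L : ℂ))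
    (hΩ : Ω = ω ^ 2 * L * C) :
    (2 * Ω < 9 * (4 - Real.sqrt 15) →
      ∀ Z : ℂ, Z = Complex.I / ((10 * ω * C : ℝ) : ℂ) *
          ((2 * Ω + 9 - Real.sqrt (4 * Ω ^ 2 + 81 - 144 * Ω) : ℝ) : ℂ) →
        Z ≠ 0 ∧ 3 * Z_C + 5 * Z / 3 ≠ 0 ∧
          1 / Z = 1 / Z_L + 1 / (3 * Z_C + 5 * Z / 3) ∧ Z.re = 0) ∧
    (2 * Ω > 9 * (4 + Real.sqrt 15) →
      ∀ Z : ℂ, Z = Complex.I / ((10 * ω * C : ℝ) : ℂ) *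
          ((2 * Ω + 9 + Real.sqrt (4 * Ω ^ 2 + 81 - 144 * Ω) : ℝ) : ℂ) →
        Z ≠ 0 ∧ 3 * Z_C + 5 * Z / 3 ≠ 0 ∧
          1 / Z = 1 / Z_L + 1 / (3 * Z_C + 5 * Z / 3) ∧ Z.re = 0) := by
  have h15 : Real.sqrt 15 ^ 2 = 15 := Real.sq_sqrt (by norm_num)
  have h15' : 0 ≤ Real.sqrt 15 := Real.sqrt_nonneg 15
  refine ⟨fun h Z hZ => ?_, fun h Z hZ => ?_⟩
  · have hD : 0 ≤ 4 * Ω ^ 2 + 81 - 144 * Ω := by nlinarith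
    refine fsl_impedance_of_sq_eq_discrim (s := -Real.sqrt (4 * Ω ^ 2 + 81 - 144 * Ω))
      hω hL hC hZC hZL hΩ ?_ ?_
    · rw [neg_sq, Real.sq_sqrt hD]
    · rw [hZ, sub_eq_add_neg (2 * Ω + 9)]
  · have hD : 0 ≤ 4 * Ω ^ 2 + 81 - 144 * Ω := by nlinarith
    exact fsl_impedance_of_sq_eq_discrim hω hL hC hZC hZL hΩ (Real.sq_sqrt hD) hZ
end

section
/- Let ω, L, C be positive reals, Z_C = 1/(iωC), Z_L = iωL, and Ω = ω²LC, and assume the filter condition 9(4−√15) < 2Ω < 9(4+√15). Define F(W) = (5·Z_L·W + 9·Z_L·Z_C)/(5W + 3Z_L + 9Z_C). Suppose (Z_N)_{N≥0} is a sequence of complex numbers such that 5Z_N + 3Z_L + 9Z_C ≠ 0 and Z_{N+1} = F(Z_N) for all N, and such that Z_0 is not a root of the fixed-point equation 5W² + (9Z_C − 2Z_L)W − 9·Z_L·Z_C = 0. Then the sequence (Z_N) does not converge to any limit in ℂ. -/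
/-- A fractional linear transformation `w ↦ (a * w + b) / (c * w + d)` maps the displacement from
a fixed point `p` to a multiple of that displacement. -/
lemma moebius_sub_fixedPoint_mul {a b c d p w w' : ℂ} (hp : c * p ^ 2 + (d - a) * p - b = 0)
    (hw : w' * (c * w + d) = a * w + b) :
    (w' - p) * (c * w + d) = (a - c * p) * (w - p) := by
  linear_combination hw - hp

/-- An orbit of a fractional linear transformation with two distinct fixed points and multiplier of
norm one does not converge, unless it starts at a fixed point. -/
lemma not_exists_tendsto_moebius_orbit {a b c d p q : ℂ} {z : ℕ → ℂ} (hc : c ≠ 0) (hpq : p ≠ q)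
    (hfix : ∀ w, c * w ^ 2 + (d - a) * w - b = c * ((w - p) * (w - q)))
    (hnorm : ‖a - c * p‖ = ‖a - c * q‖) (hne : ∀ n, c * z n + d ≠ 0)
    (hrec : ∀ n, z (n + 1) * (c * z n + d) = a * z n + b)
    (hinit : c * z 0 ^ 2 + (d - a) * z 0 - b ≠ 0) :
    ¬ ∃ l : ℂ, Filter.Tendsto z Filter.atTop (nhds l) := by
  rintro ⟨l, hl⟩
  have hp : c * p ^ 2 + (d - a) * p - b = 0 := by rw [hfix]; ring
  have hq : c * q ^ 2 + (d - a) * q - b = 0 := by rw [hfix]; ring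
  have hzp : z 0 - p ≠ 0 := fun h => hinit (by rw [hfix, h]; ring)
  have hzq : z 0 - q ≠ 0 := fun h => hinit (by rw [hfix, h]; ring)
  have hratio : ∀ n, ‖z n - p‖ * ‖z 0 - q‖ = ‖z n - q‖ * ‖z 0 - p‖ := by
    intro n
    induction n with
    | zero => ring
    | succ n ih =>
      have h₁ := congrArg norm (moebius_sub_fixedPoint_mul hp (hrec n))
      have h₂ := congrArg norm (moebius_sub_fixedPoint_mul hq (hrec n))
      simp only [norm_mul] at h₁ h₂
      rw [hnorm] at h₁
      refine mul_right_cancel₀ (norm_ne_zero_iff.mpr (hne n)) ?_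
      linear_combination ‖z 0 - q‖ * h₁ - ‖z 0 - p‖ * h₂ + ‖a - c * q‖ * ih
  have hlim : ‖l - p‖ * ‖z 0 - q‖ = ‖l - q‖ * ‖z 0 - p‖ :=
    tendsto_nhds_unique (((hl.sub_const p).norm.mul_const _).congr hratio)
      ((hl.sub_const q).norm.mul_const _)
  have hlfix : l * (c * l + d) = a * l + b :=
    tendsto_nhds_unique
      (((hl.comp (Filter.tendsto_add_atTop_nat 1)).mul ((hl.const_mul c).add_const d)).congr hrec)
      ((hl.const_mul a).add_const b)
  have hroot : c * ((l - p) * (l - q)) = 0 := by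
    rw [← hfix]
    linear_combination hlfix
  rcases mul_eq_zero.mp ((mul_eq_zero.mp hroot).resolve_left hc) with h | h
  · obtain rfl := sub_eq_zero.mp h
    simp [sub_eq_zero, hpq, sub_ne_zero.mp hzp] at hlim
  · obtain rfl := sub_eq_zero.mp h
    simp [sub_eq_zero, hpq.symm, sub_ne_zero.mp hzq] at hlim


/-- Feynman–Sierpinski Ladder: under the filter condition, the sequence of
characteristic impedances of the finite approximations, generated by the
fractional linear transformation `F`, does not converge (unless started at a
fixed point). -/
theorem fsl_finite_approximations_diverge (ω L C : ℝ) (hω : 0 < ω) (hL : 0 < L) (hC : 0 < C)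
    (Z_C Z_L : ℂ) (Ω : ℝ)
    (hZC : Z_C = 1 / (Complex.I * (ω : ℂ) * (C : ℂ)))
    (hZL : Z_L = Complex.I * (ω : ℂ) * (L : ℂ))
    (hΩ : Ω = ω ^ 2 * L * C)
    (hfilter1 : 9 * (4 - Real.sqrt 15) < 2 * Ω)
    (hfilter2 : 2 * Ω < 9 * (4 + Real.sqrt 15))
    (Zseq : ℕ → ℂ)
    (hne : ∀ N, 5 * Zseq N + 3 * Z_L + 9 * Z_C ≠ 0)
    (hrec : ∀ N, Zseq (N + 1) =
      (5 * Z_L * Zseq N + 9 * Z_L * Z_C) / (5 * Zseq N + 3 * Z_L + 9 * Z_C))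
    (hinit : ¬ (5 * Zseq 0 ^ 2 + (9 * Z_C - 2 * Z_L) * Zseq 0 - 9 * Z_L * Z_C = 0)) :
    ¬ ∃ l : ℂ, Filter.Tendsto Zseq Filter.atTop (nhds l) := by
  obtain ⟨x, y, hx, hy, hD⟩ : ∃ x y : ℝ, Z_L = Complex.I * x ∧ Z_C = -Complex.I * y ∧
      0 < 180 * x * y - (9 * y + 2 * x) ^ 2 := by
    have hωC : 0 < ω * C := mul_pos hω hC
    refine ⟨ω * L, 1 / (ω * C), by rw [hZL]; push_cast; ring, ?_, ?_⟩
    · rw [hZC]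
      have hω' : (ω : ℂ) ≠ 0 := by exact_mod_cast hω.ne'
      have hC' : (C : ℂ) ≠ 0 := by exact_mod_cast hC.ne'
      push_cast
      field_simp
      simp
    · have hsq : Real.sqrt 15 ^ 2 = 15 := Real.sq_sqrt (by norm_num)
      have hquad : 0 < 144 * Ω - 4 * Ω ^ 2 - 81 := by
        nlinarith [mul_pos (sub_pos.mpr hfilter1) (sub_pos.mpr hfilter2)]
      have hdisc : 180 * (ω * L) * (1 / (ω * C)) - (9 * (1 / (ω * C)) + 2 * (ω * L)) ^ 2 =
          (144 * Ω - 4 * Ω ^ 2 - 81) / (ω * C) ^ 2 := by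
        rw [hΩ]
        field_simp
        ring
      rw [hdisc]
      positivity
  obtain ⟨s, hs, hs_sq⟩ : ∃ s : ℝ, 0 < s ∧ s ^ 2 = 180 * x * y - (9 * y + 2 * x) ^ 2 :=
    ⟨_, Real.sqrt_pos.mpr hD, Real.sq_sqrt hD.le⟩
  have hs' : (s : ℂ) ^ 2 = 180 * x * y - (9 * y + 2 * x) ^ 2 := by exact_mod_cast hs_sq
  have hs₀ : (s : ℂ) ≠ 0 := by exact_mod_cast hs.ne'
  refine not_exists_tendsto_moebius_orbit (a := 5 * Z_L) (b := 9 * Z_L * Z_C) (c := 5)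
    (d := 3 * Z_L + 9 * Z_C) (p := (Complex.I * (9 * y + 2 * x) + s) / 10)
    (q := (Complex.I * (9 * y + 2 * x) - s) / 10) (by norm_num) ?_ ?_ ?_ ?_ ?_ ?_
  · intro h
    apply hs₀
    linear_combination 5 * h
  · intro w
    rw [hx, hy]
    linear_combination (1 / 20 : ℂ) * hs' + (9 * x * y - (9 * y + 2 * x) ^ 2 / 20) * Complex.I_sq
  · rw [hx, Complex.norm_def, Complex.norm_def]
    congr 1
    simp [Complex.normSq_apply]
    ring
  · intro N
    rw [← add_assoc]
    exact hne N
  · intro N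
    rw [hrec N, ← add_assoc, div_mul_cancel₀ _ (hne N)]
  · intro h
    apply hinit
    linear_combination h
end

section
/- Let ω, L, C be positive reals, Z_C = 1/(iωC), Z_L = iωL, and assume the filter condition 9(4−√15) < 2ω²LC < 9(4+√15). Fix ε > 0, let F_ε(W) = (5(Z_L+ε)W + 9(Z_L+ε)(Z_C+ε))/(5W + 3(Z_L+ε) + 9(Z_C+ε)), and let Z_ε = (1/10)·(−9(Z_C+ε) + 2(Z_L+ε) + ((9(Z_C+ε) + 8(Z_L+ε))² − 60(Z_L+ε)²)^{1/2}) with the principal branch of the complex square root. Then Z_ε is a fixed point of F_ε; and if (Z_N)_{N≥0} is any sequence with 5Z_N + 3(Z_L+ε) + 9(Z_C+ε) ≠ 0 and Z_{N+1} = F_ε(Z_N) for all N, whose initial point Z_0 is not the other root of the fixed-point equation 5W² + (9(Z_C+ε) − 2(Z_L+ε))W − 9(Z_L+ε)(Z_C+ε) = 0, then Z_N converges to Z_ε as N → ∞. -/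
open Filter Topology in
/-- If an orbit has two distinct marked points `P`, `Q` such that the cross-ratio coordinate
`(Z - P) / (Z - Q)` is multiplied at each step by `α / β` with `‖α‖ < ‖β‖`, then the orbit
converges to `P` unless it starts at `Q`. -/
theorem tendsto_of_moebius_orbit {P Q α β : ℂ} (hPQ : P ≠ Q) (hαβ : ‖α‖ < ‖β‖)
    {Z d : ℕ → ℂ} (hd : ∀ N, d N ≠ 0) (hP : ∀ N, Z (N + 1) - P = α * (Z N - P) / d N)
    (hQ : ∀ N, Z (N + 1) - Q = β * (Z N - Q) / d N) (h0 : Z 0 ≠ Q) :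
    Tendsto Z atTop (𝓝 P) := by
  have hβ : β ≠ 0 := norm_pos_iff.1 ((norm_nonneg α).trans_lt hαβ)
  have hne : ∀ N, Z N - Q ≠ 0 := by
    intro N
    induction N with
    | zero => exact sub_ne_zero.2 h0
    | succ N ih =>
      rw [hQ N]
      exact div_ne_zero (mul_ne_zero hβ ih) (hd N)
  have hw : ∀ N, (Z N - P) / (Z N - Q) = (α / β) ^ N * ((Z 0 - P) / (Z 0 - Q)) := by
    intro N
    induction N with
    | zero => simp
    | succ N ih =>
      have h1 := hd N
      have h2 := hne N
      rw [pow_succ, mul_right_comm, ← ih, hP N, hQ N]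
      field_simp
  have hlim : Tendsto (fun N => (Z N - P) / (Z N - Q)) atTop (𝓝 0) := by
    have hr : ‖α / β‖ < 1 := by
      rw [norm_div]
      exact (div_lt_one (norm_pos_iff.2 hβ)).2 hαβ
    have h := (tendsto_pow_atTop_nhds_zero_of_norm_lt_one hr).mul_const
      ((Z 0 - P) / (Z 0 - Q))
    rw [zero_mul] at h
    exact h.congr fun N => (hw N).symm
  have hZ : ∀ N, Z N =
      (P - Q * ((Z N - P) / (Z N - Q))) / (1 - (Z N - P) / (Z N - Q)) := by
    intro N
    have h2 := hne N
    have h3 : 1 - (Z N - P) / (Z N - Q) = (P - Q) / (Z N - Q) := by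
      field_simp
      ring
    have h4 := sub_ne_zero.2 hPQ
    rw [h3]
    field_simp
    ring
  have hfin : Tendsto (fun N => (P - Q * ((Z N - P) / (Z N - Q))) /
      (1 - (Z N - P) / (Z N - Q))) atTop (𝓝 ((P - Q * 0) / (1 - 0))) :=
    (tendsto_const_nhds.sub (hlim.const_mul Q)).div (tendsto_const_nhds.sub hlim) (by simp)
  rw [mul_zero, sub_zero, sub_zero, div_one] at hfin
  exact hfin.congr fun N => (hZ N).symm

theorem Complex.re_cpow_one_half_nonneg (z : ℂ) : 0 ≤ (z ^ ((1 : ℂ) / 2)).re := by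
  rcases eq_or_ne z 0 with rfl | hz
  · simp
  · have him : (Complex.log z * (1 / 2)).im = Complex.arg z / 2 := by
      rw [show (1 / 2 : ℂ) = ((1 / 2 : ℝ) : ℂ) by norm_num, Complex.im_mul_ofReal,
        Complex.log_im]
      ring
    rw [Complex.cpow_def_of_ne_zero hz, Complex.exp_re, him]
    refine mul_nonneg (Real.exp_pos _).le (Real.cos_nonneg_of_mem_Icc ⟨?_, ?_⟩)
    · linarith [Complex.neg_pi_lt_arg z]
    · linarith [Complex.arg_le_pi z]

theorem Complex.cpow_one_half_sq (z : ℂ) : (z ^ ((1 : ℂ) / 2)) ^ 2 = z := by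
  simp

theorem Complex.norm_sub_lt_norm_add {z w : ℂ} (h : 0 < z.re * w.re + z.im * w.im) :
    ‖z - w‖ < ‖z + w‖ := by
  refine lt_of_pow_lt_pow_left₀ 2 (norm_nonneg _) ?_
  rw [← Complex.normSq_eq_norm_sq, ← Complex.normSq_eq_norm_sq, Complex.normSq_apply,
    Complex.normSq_apply]
  simp only [Complex.sub_re, Complex.sub_im, Complex.add_re, Complex.add_im]
  nlinarith

/-- The quadratic form of the filter condition. -/
theorem filter_quadratic_neg {u : ℝ} (h1 : 9 * (4 - Real.sqrt 15) < 2 * u)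
    (h2 : 2 * u < 9 * (4 + Real.sqrt 15)) : 4 * u ^ 2 - 144 * u + 81 < 0 := by
  have h15 : Real.sqrt 15 ^ 2 = 15 := Real.sq_sqrt (by norm_num)
  nlinarith [mul_pos (sub_pos.2 h1) (sub_pos.2 h2)]

/-- Positivity of the real inner product of `T = 17ε + iy` with a square root `p + iq` of
`T² - 60(ε + ix)²` lying in the closed right half-plane. -/
theorem sqrt_inner_pos {ε x y p q : ℝ} (hε : 0 < ε) (hx : 0 < x) (hyx : y < 17 * x)
    (hxy : y ^ 2 < 60 * x ^ 2) (hp : 0 ≤ p)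
    (hre : p ^ 2 - q ^ 2 = 229 * ε ^ 2 + 60 * x ^ 2 - y ^ 2)
    (him : p * q = ε * (17 * y - 60 * x)) : 0 < 17 * ε * p + y * q := by
  have hp0 : 0 < p := by
    refine hp.lt_of_ne' fun h => ?_
    subst h
    nlinarith [sq_nonneg q, sq_nonneg ε]
  refine pos_of_mul_pos_right (a := p) ?_ hp
  have key : p * (17 * ε * p + y * q) =
      ε * (17 * q ^ 2 + 17 * 229 * ε ^ 2 + 60 * (x * (17 * x - y))) := by
    linear_combination 17 * ε * hre + y * him
  rw [key]
  have := mul_pos hx (sub_pos.2 hyx)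
  positivity


/-- Regularized Feynman–Sierpinski Ladder: under the filter condition, `Z_ε` is a
fixed point of the regularized recursion `F_ε`, and any orbit of `F_ε` not
starting at the other fixed point converges to `Z_ε`. -/
theorem fsl_regularized_convergence (ω L C : ℝ) (hω : 0 < ω) (hL : 0 < L) (hC : 0 < C)
    (Z_C Z_L : ℂ)
    (hZC : Z_C = 1 / (Complex.I * (ω : ℂ) * (C : ℂ)))
    (hZL : Z_L = Complex.I * (ω : ℂ) * (L : ℂ))
    (hfilter1 : 9 * (4 - Real.sqrt 15) < 2 * (ω ^ 2 * L * C))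
    (hfilter2 : 2 * (ω ^ 2 * L * C) < 9 * (4 + Real.sqrt 15))
    (ε : ℝ) (hε : 0 < ε) (Zε : ℂ)
    (hZε : Zε = (1 / 10 : ℂ) * (-9 * (Z_C + (ε : ℂ)) + 2 * (Z_L + (ε : ℂ)) +
      ((9 * (Z_C + (ε : ℂ)) + 8 * (Z_L + (ε : ℂ))) ^ 2 -
        60 * (Z_L + (ε : ℂ)) ^ 2) ^ ((1 : ℂ) / 2))) :
    Zε = (5 * (Z_L + (ε : ℂ)) * Zε + 9 * (Z_L + (ε : ℂ)) * (Z_C + (ε : ℂ))) /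
      (5 * Zε + 3 * (Z_L + (ε : ℂ)) + 9 * (Z_C + (ε : ℂ))) ∧
    ∀ Zseq : ℕ → ℂ,
      (∀ N, 5 * Zseq N + 3 * (Z_L + (ε : ℂ)) + 9 * (Z_C + (ε : ℂ)) ≠ 0) →
      (∀ N, Zseq (N + 1) =
        (5 * (Z_L + (ε : ℂ)) * Zseq N + 9 * (Z_L + (ε : ℂ)) * (Z_C + (ε : ℂ))) /
          (5 * Zseq N + 3 * (Z_L + (ε : ℂ)) + 9 * (Z_C + (ε : ℂ)))) →
      (∀ W : ℂ, 5 * W ^ 2 + (9 * (Z_C + (ε : ℂ)) - 2 * (Z_L + (ε : ℂ))) * W -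
          9 * (Z_L + (ε : ℂ)) * (Z_C + (ε : ℂ)) = 0 → W ≠ Zε → Zseq 0 ≠ W) →
      Filter.Tendsto Zseq Filter.atTop (nhds Zε) := by
  set a : ℂ := Z_C + (ε : ℂ) with ha
  set b : ℂ := Z_L + (ε : ℂ) with hb
  set S : ℂ := ((9 * a + 8 * b) ^ 2 - 60 * b ^ 2) ^ ((1 : ℂ) / 2) with hS
  have hS2 : S ^ 2 = (9 * a + 8 * b) ^ 2 - 60 * b ^ 2 := Complex.cpow_one_half_sq _
  have hSre : 0 ≤ S.re := Complex.re_cpow_one_half_nonneg _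
  clear_value S
  have hk : Z_C = -(((ω * C)⁻¹ : ℝ) : ℂ) * Complex.I := by
    have h1 : (ω : ℂ) ≠ 0 := by exact_mod_cast hω.ne'
    have h2 : (C : ℂ) ≠ 0 := by exact_mod_cast hC.ne'
    rw [hZC]
    push_cast
    field_simp
    simp
  have hkpos : 0 < (ω * C)⁻¹ := by positivity
  have hxpos : 0 < ω * L := by positivity
  have huk : ω ^ 2 * L * C * (ω * C)⁻¹ = ω * L := by field_simp
  set u : ℝ := ω ^ 2 * L * C
  set k : ℝ := (ω * C)⁻¹
  set x : ℝ := ω * L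
  have hquad := filter_quadratic_neg hfilter1 hfilter2
  have hare : a.re = ε := by simp [ha, hk]
  have haim : a.im = -k := by simp [ha, hk]
  have hbre : b.re = ε := by simp [hb, hZL]
  have hbim : b.im = x := by simp [hb, hZL, x]
  clear_value a b
  have hb0 : b ≠ 0 := by
    rintro rfl
    exact hε.ne hbre
  have hTre : (9 * a + 8 * b).re = 17 * ε := by
    simp [hare, hbre]
    ring
  have hTim : (9 * a + 8 * b).im = 8 * x - 9 * k := by
    simp [haim, hbim]
    ring
  have hre : S.re ^ 2 - S.im ^ 2 = 229 * ε ^ 2 + 60 * x ^ 2 - (8 * x - 9 * k) ^ 2 := by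
    have h := congrArg Complex.re hS2
    rw [pow_two, pow_two, pow_two, Complex.sub_re, Complex.mul_re, Complex.mul_re, hTre, hTim,
      show (60 : ℂ) = ((60 : ℝ) : ℂ) by norm_num, Complex.re_ofReal_mul, Complex.mul_re, hbre,
      hbim] at h
    linear_combination h
  have him : S.re * S.im = ε * (17 * (8 * x - 9 * k) - 60 * x) := by
    have h := congrArg Complex.im hS2
    rw [pow_two, pow_two, pow_two, Complex.sub_im, Complex.mul_im, Complex.mul_im, hTre, hTim,
      show (60 : ℂ) = ((60 : ℝ) : ℂ) by norm_num, Complex.im_ofReal_mul, Complex.mul_im, hbre,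
      hbim] at h
    linear_combination h / 2
  have hxy : (8 * x - 9 * k) ^ 2 < 60 * x ^ 2 := by
    rw [← huk]
    nlinarith [mul_pos_of_neg_of_neg hquad (neg_neg_of_pos (pow_pos hkpos 2))]
  have hnorm : ‖(9 * a + 8 * b) - S‖ < ‖(9 * a + 8 * b) + S‖ := by
    apply Complex.norm_sub_lt_norm_add
    rw [hTre, hTim]
    exact sqrt_inner_pos hε hxpos (by linarith) hxy hSre hre him
  have hS0 : S ≠ 0 := by
    rintro rfl
    simp at hnorm
  have hTS : (9 * a + 8 * b) + S ≠ 0 := norm_pos_iff.1 ((norm_nonneg _).trans_lt hnorm)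
  have hden : 5 * Zε + 3 * b + 9 * a ≠ 0 := by
    rw [show 5 * Zε + 3 * b + 9 * a = ((9 * a + 8 * b) + S) / 2 by rw [hZε]; ring]
    exact div_ne_zero hTS two_ne_zero
  refine ⟨?_, fun Zseq hd hrec hW => ?_⟩
  · rw [eq_div_iff hden, hZε]
    linear_combination hS2 / 20
  · have hne : (1 / 10 : ℂ) * (-9 * a + 2 * b - S) ≠ Zε := by
      intro h
      apply hS0
      rw [hZε] at h
      linear_combination -5 * h
    refine tendsto_of_moebius_orbit (Q := (1 / 10 : ℂ) * (-9 * a + 2 * b - S))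
      (α := ((9 * a + 8 * b) - S) / 2) (β := ((9 * a + 8 * b) + S) / 2)
      (d := fun N => 5 * Zseq N + 3 * b + 9 * a) hne.symm ?_ hd ?_ ?_ ?_
    · rw [norm_div, norm_div]
      gcongr
      simp
    · intro N
      rw [hrec N, hZε, eq_div_iff (hd N), sub_mul, div_mul_cancel₀ _ (hd N)]
      linear_combination -hS2 / 20
    · intro N
      rw [hrec N, eq_div_iff (hd N), sub_mul, div_mul_cancel₀ _ (hd N)]
      linear_combination -hS2 / 20
    · refine hW _ ?_ hne
      linear_combination hS2 / 20
end

section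
/- Let ω, L, C be positive reals, Z_C = 1/(iωC), Z_L = iωL, Ω = ω²LC, and assume the filter condition 9(4−√15) < 2Ω < 9(4+√15). For ε > 0 define Z_ε = (1/10)·(−9(Z_C+ε) + 2(Z_L+ε) + ((9(Z_C+ε) + 8(Z_L+ε))² − 60(Z_L+ε)²)^{1/2}) with the principal branch of the complex square root. Then Z_ε tends, as ε → 0 from the right, to Z = (1/(10ωC))·((9+2Ω)·i + √(144Ω − 4Ω² − 81)), the characteristic impedance of the unregularized Feynman–Sierpinski Ladder. -/
/-- The filter condition is exactly what makes the radicand positive. -/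
theorem radicand_pos {x : ℝ} (h₁ : 9 * (4 - Real.sqrt 15) < 2 * x)
    (h₂ : 2 * x < 9 * (4 + Real.sqrt 15)) : 0 < 144 * x - 4 * x ^ 2 - 81 := by
  have h15 : Real.sqrt 15 ^ 2 = 15 := Real.sq_sqrt (by norm_num)
  nlinarith [mul_pos (sub_pos.2 h₁) (sub_pos.2 h₂)]

/-- The principal complex square root agrees with `Real.sqrt` on nonnegative reals. -/
theorem ofReal_cpow_half {x : ℝ} (hx : 0 ≤ x) :
    (x : ℂ) ^ ((1 : ℂ) / 2) = (Real.sqrt x : ℂ) := by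
  rw [Real.sqrt_eq_rpow, Complex.ofReal_cpow hx]
  norm_num

/-- Regularized Feynman–Sierpinski Ladder: as `ε → 0⁺`, the regularized fixed
point `Z_ε` converges to the characteristic impedance `Z` of the unregularized
circuit. -/
theorem fsl_regularized_limit (ω L C : ℝ) (hω : 0 < ω) (hL : 0 < L) (hC : 0 < C)
    (Z_C Z_L Z : ℂ) (Ω : ℝ)
    (hZC : Z_C = 1 / (Complex.I * (ω : ℂ) * (C : ℂ)))
    (hZL : Z_L = Complex.I * (ω : ℂ) * (L : ℂ))
    (hΩ : Ω = ω ^ 2 * L * C)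
    (hfilter1 : 9 * (4 - Real.sqrt 15) < 2 * Ω)
    (hfilter2 : 2 * Ω < 9 * (4 + Real.sqrt 15))
    (hZ : Z = ((1 / (10 * ω * C) : ℝ) : ℂ) *
      (((9 + 2 * Ω : ℝ) : ℂ) * Complex.I +
        ((Real.sqrt (144 * Ω - 4 * Ω ^ 2 - 81) : ℝ) : ℂ))) :
    Filter.Tendsto
      (fun ε : ℝ => (1 / 10 : ℂ) * (-9 * (Z_C + (ε : ℂ)) + 2 * (Z_L + (ε : ℂ)) +
        ((9 * (Z_C + (ε : ℂ)) + 8 * (Z_L + (ε : ℂ))) ^ 2 -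
          60 * (Z_L + (ε : ℂ)) ^ 2) ^ ((1 : ℂ) / 2)))
      (nhdsWithin 0 (Set.Ioi 0)) (nhds Z) := by
  have hD := radicand_pos hfilter1 hfilter2
  have hωC : 0 < ω * C := mul_pos hω hC
  have hω' : (ω : ℂ) ≠ 0 := by exact_mod_cast hω.ne'
  have hC' : (C : ℂ) ≠ 0 := by exact_mod_cast hC.ne'
  have hZC' : Z_C = -Complex.I / (ω * C) := by
    rw [hZC]
    field_simp
    simp
  have hlimit : (9 * Z_C + 8 * Z_L) ^ 2 - 60 * Z_L ^ 2 =
      (((144 * Ω - 4 * Ω ^ 2 - 81) / (ω * C) ^ 2 : ℝ) : ℂ) := by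
    rw [hZC', hZL, hΩ]
    push_cast
    field_simp
    linear_combination (4 * (ω : ℂ) ^ 4 * L ^ 2 * C ^ 2 - 144 * ω ^ 2 * L * C + 81) *
      Complex.I_sq
  have hslit : (9 * (Z_C + ((0 : ℝ) : ℂ)) + 8 * (Z_L + ((0 : ℝ) : ℂ))) ^ 2 -
      60 * (Z_L + ((0 : ℝ) : ℂ)) ^ 2 ∈ Complex.slitPlane := by
    simp only [Complex.ofReal_zero, add_zero]
    rw [hlimit]
    exact Complex.ofReal_mem_slitPlane.2 (by positivity)
  have hcont : ContinuousAt
      (fun ε : ℝ => (1 / 10 : ℂ) * (-9 * (Z_C + (ε : ℂ)) + 2 * (Z_L + (ε : ℂ)) +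
        ((9 * (Z_C + (ε : ℂ)) + 8 * (Z_L + (ε : ℂ))) ^ 2 -
          60 * (Z_L + (ε : ℂ)) ^ 2) ^ ((1 : ℂ) / 2))) 0 := by
    refine continuousAt_const.mul (ContinuousAt.add (by fun_prop) ?_)
    exact ContinuousAt.cpow (by fun_prop) continuousAt_const hslit
  convert hcont.tendsto.mono_left nhdsWithin_le_nhds using 2
  simp only [Complex.ofReal_zero, add_zero]
  rw [hlimit, ofReal_cpow_half (by positivity), Real.sqrt_div hD.le, Real.sqrt_sq hωC.le,
    hZ, hZC', hZL]
  generalize Real.sqrt (144 * Ω - 4 * Ω ^ 2 - 81) = r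
  rw [hΩ]
  push_cast
  field_simp
end

section
/- Let Z, Z_C be complex numbers with Z ≠ 0, Z_C ≠ 0, and 9Z_C + 5Z ≠ 0. Let K be the 3×3 complex matrix with diagonal entries 2 and off-diagonal entries −1, and let M = (9Z_C + 5Z)⁻¹ · [[3Z_C + 5Z, 3Z_C, 3Z_C], [3Z_C, 3Z_C + 5Z, 3Z_C], [3Z_C, 3Z_C, 3Z_C + 5Z]]. Then for every vector v ∈ ℂ³, the vector w = M·v satisfies (3/(5Z))·K·w + (1/Z_C)·(w − v) = 0. -/
/-- Feynman–Sierpinski Ladder harmonic interpolation: the matrix `M` solves the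
Kirchhoff current equation `(3/(5Z))·K·(Mv) + (1/Z_C)·(Mv − v) = 0` for every
boundary voltage vector `v`. -/
theorem fsl_harmonic_matrix (Z Z_C : ℂ) (hZ : Z ≠ 0) (hZC : Z_C ≠ 0)
    (hden : 9 * Z_C + 5 * Z ≠ 0)
    (K M : Matrix (Fin 3) (Fin 3) ℂ)
    (hK : K = !![2, -1, -1; -1, 2, -1; -1, -1, 2])
    (hM : M = (9 * Z_C + 5 * Z)⁻¹ •
      !![3 * Z_C + 5 * Z, 3 * Z_C, 3 * Z_C;
         3 * Z_C, 3 * Z_C + 5 * Z, 3 * Z_C;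
         3 * Z_C, 3 * Z_C, 3 * Z_C + 5 * Z]) :
    ∀ v : Fin 3 → ℂ,
      (3 / (5 * Z)) • K.mulVec (M.mulVec v) + (1 / Z_C) • (M.mulVec v - v) = 0 := by
  intro v
  subst hK hM
  ext i
  fin_cases i <;>
    simp [Matrix.vecHead, Matrix.vecTail] <;>
    field_simp <;>
    ring
end

section
/- Let r be a real number and Z_1, Z_2, Z_C, Z_L complex numbers with 2rZ_2 + Z_L ≠ 0, rZ_1 + rZ_2 + Z_C ≠ 0, and 1/(2rZ_2 + Z_L) + (1/2)·(1/(rZ_1 + rZ_2 + Z_C)) ≠ 0. Suppose that Z_1 + (1/2)Z_2 = rZ_1 + (1/2)(rZ_1 + 2rZ_2 + Z_C) and 2Z_2 = 2rZ_2 + (1/(2rZ_2 + Z_L) + (1/2)·(1/(rZ_1 + rZ_2 + Z_C)))⁻¹. Then r ≠ 1; and if moreover r ≠ 2/3, then Z_1 = ((2r−1)Z_2 + Z_C)/(2 − 3r) and r(5r−3)·Z_2² + (2r−1)(2Z_C + Z_L)·Z_2 + Z_C·Z_L = 0. -/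
/-- Hanoi I circuit: the Kirchhoff self-consistency equations imply `r ≠ 1`,
and if `r ≠ 2/3` they give the formula for `Z₁` and the quadratic for `Z₂`. -/
theorem hanoi1_equations (r : ℝ) (Z1 Z2 Z_C Z_L : ℂ)
    (h1 : 2 * (r : ℂ) * Z2 + Z_L ≠ 0)
    (h2 : (r : ℂ) * Z1 + (r : ℂ) * Z2 + Z_C ≠ 0)
    (h3 : 1 / (2 * (r : ℂ) * Z2 + Z_L) +
      (1 / 2) * (1 / ((r : ℂ) * Z1 + (r : ℂ) * Z2 + Z_C)) ≠ 0)
    (heq1 : Z1 + (1 / 2) * Z2 =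
      (r : ℂ) * Z1 + (1 / 2) * ((r : ℂ) * Z1 + 2 * (r : ℂ) * Z2 + Z_C))
    (heq2 : 2 * Z2 = 2 * (r : ℂ) * Z2 + (1 / (2 * (r : ℂ) * Z2 + Z_L) +
      (1 / 2) * (1 / ((r : ℂ) * Z1 + (r : ℂ) * Z2 + Z_C)))⁻¹) :
    r ≠ 1 ∧ (r ≠ 2 / 3 →
      Z1 = ((2 * (r : ℂ) - 1) * Z2 + Z_C) / (2 - 3 * (r : ℂ)) ∧
      (r : ℂ) * (5 * (r : ℂ) - 3) * Z2 ^ 2 +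
        (2 * (r : ℂ) - 1) * (2 * Z_C + Z_L) * Z2 + Z_C * Z_L = 0) := by
  have hr : r ≠ 1 := by
    rintro rfl
    apply inv_ne_zero h3
    push_cast at heq2 ⊢
    linear_combination -heq2
  refine ⟨hr, fun hr' => ?_⟩
  have hrc : (1 - (r : ℂ)) ≠ 0 := sub_ne_zero.mpr (by exact_mod_cast hr.symm)
  have hrc' : (2 - 3 * (r : ℂ)) ≠ 0 := by
    intro h
    have h' : 2 - 3 * r = 0 := by exact_mod_cast h
    exact hr' (by linarith)
  have hZ1 : (2 - 3 * (r : ℂ)) * Z1 = (2 * (r : ℂ) - 1) * Z2 + Z_C := by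
    linear_combination 2 * heq1
  refine ⟨by rw [eq_div_iff hrc', mul_comm, hZ1], ?_⟩
  have hinv : 2 * (1 - (r : ℂ)) * Z2 * (1 / (2 * (r : ℂ) * Z2 + Z_L) +
      (1 / 2) * (1 / ((r : ℂ) * Z1 + (r : ℂ) * Z2 + Z_C))) = 1 := by
    rw [← eq_div_iff_mul_eq h3, one_div (_ + _)]
    linear_combination heq2
  have hcleared : (1 - (r : ℂ)) * Z2 * (2 * ((r : ℂ) * Z1 + (r : ℂ) * Z2 + Z_C) +
      (2 * (r : ℂ) * Z2 + Z_L)) =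
      (2 * (r : ℂ) * Z2 + Z_L) * ((r : ℂ) * Z1 + (r : ℂ) * Z2 + Z_C) := by
    generalize 2 * (r : ℂ) * Z2 + Z_L = D at *
    generalize (r : ℂ) * Z1 + (r : ℂ) * Z2 + Z_C = S at *
    field_simp at hinv
    linear_combination hinv
  refine (mul_eq_zero.mp ?_).resolve_left (mul_ne_zero (by norm_num : (-2 : ℂ) ≠ 0) hrc)
  linear_combination (2 - 3 * (r : ℂ)) * hcleared -
    (2 * (1 - (r : ℂ)) * Z2 - (2 * (r : ℂ) * Z2 + Z_L)) * r * hZ1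
end

section
/- Let r be a real number with r ≥ 3/5, let ω, L, C be positive reals, and set Z_C = 1/(iωC) and Z_L = iωL. Then every complex number Z_2 satisfying r(5r−3)·Z_2² + (2r−1)(2Z_C + Z_L)·Z_2 + Z_C·Z_L = 0 is purely imaginary, i.e. Re(Z_2) = 0. -/
/-- A root of a quadratic with nonnegative leading coefficient, imaginary linear coefficient and
positive constant coefficient is purely imaginary. -/
theorem re_eq_zero_of_quadratic {a b q : ℝ} (ha : 0 ≤ a) (hq : 0 < q) {z : ℂ}
    (h : (a : ℂ) * z ^ 2 + (b : ℂ) * Complex.I * z + (q : ℂ) = 0) : z.re = 0 := by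
  by_contra hx
  have hre : a * (z.re ^ 2 - z.im ^ 2) - b * z.im + q = 0 := by
    have := congrArg Complex.re h
    simp [pow_two] at this
    linear_combination this
  have him : z.re * (2 * a * z.im + b) = 0 := by
    have := congrArg Complex.im h
    simp [pow_two] at this
    linear_combination this
  have hb : 2 * a * z.im + b = 0 := (mul_eq_zero.mp him).resolve_left hx
  have hsum : a * (z.re ^ 2 + z.im ^ 2) + q = 0 := by
    linear_combination hre + z.im * hb
  have : 0 < a * (z.re ^ 2 + z.im ^ 2) + q := by positivity
  exact this.ne' hsum

/-- Hanoi I circuit: when `r ≥ 3/5`, every solution `Z₂` of the characteristic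
quadratic is purely imaginary, so the filter condition fails. -/
theorem hanoi1_no_filter_large_r (r : ℝ) (hr : 3 / 5 ≤ r)
    (ω L C : ℝ) (hω : 0 < ω) (hL : 0 < L) (hC : 0 < C)
    (Z_C Z_L : ℂ)
    (hZC : Z_C = 1 / (Complex.I * (ω : ℂ) * (C : ℂ)))
    (hZL : Z_L = Complex.I * (ω : ℂ) * (L : ℂ)) :
    ∀ Z2 : ℂ, (r : ℂ) * (5 * (r : ℂ) - 3) * Z2 ^ 2 +
      (2 * (r : ℂ) - 1) * (2 * Z_C + Z_L) * Z2 + Z_C * Z_L = 0 → Z2.re = 0 := by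
  intro Z2 h
  have hω' : (ω : ℂ) ≠ 0 := by exact_mod_cast hω.ne'
  have hC' : (C : ℂ) ≠ 0 := by exact_mod_cast hC.ne'
  have hZC' : Z_C = -((1 / (ω * C) : ℝ) : ℂ) * Complex.I := by
    rw [hZC]
    push_cast
    field_simp
    simp
  have hprod : Z_C * Z_L = ((L / C : ℝ) : ℂ) := by
    rw [hZC, hZL]
    push_cast
    field_simp
  refine re_eq_zero_of_quadratic (a := r * (5 * r - 3))
    (b := (2 * r - 1) * (ω * L - 2 * (1 / (ω * C)))) (q := L / C)
    (mul_nonneg (by linarith) (by linarith)) (div_pos hL hC) ?_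
  rw [hprod, hZC', hZL] at h
  push_cast at h ⊢
  linear_combination h
end

section
/- Let r be a real number with r ≠ 2/3 and Z_1, Z_2, Z_C, Z_L complex numbers with 2rZ_2 + Z_L ≠ 0, 2r(Z_1 + Z_2) + 2Z_C ≠ 0, and 1/(2rZ_2 + Z_L) + 1/(2r(Z_1+Z_2) + 2Z_C) ≠ 0. Suppose that Z_1 + (1/2)Z_2 = Z_L + rZ_1 + (1/2)(rZ_1 + 2rZ_2 + 2Z_C) and 2Z_2 = 2rZ_2 + 2Z_C + (1/(2rZ_2 + Z_L) + 1/(2r(Z_1+Z_2) + 2Z_C))⁻¹. Then Z_1 = ((2r−1)Z_2 + 2(Z_C + Z_L))/(2 − 3r), and 2r(1−r)(5r−3)·Z_2² + 2·(2(1−r)(3r−1)·Z_C + (2r−1)(r+1)·Z_L)·Z_2 + 2(Z_L + Z_C)·((2−r)Z_C + rZ_L) = 0. -/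
/-- Hanoi II circuit: the Kirchhoff self-consistency equations, for `r ≠ 2/3`,
give the formula for `Z₁` and the quadratic for `Z₂`. -/
theorem hanoi2_equations (r : ℝ) (hr : r ≠ 2 / 3) (Z1 Z2 Z_C Z_L : ℂ)
    (h1 : 2 * (r : ℂ) * Z2 + Z_L ≠ 0)
    (h2 : 2 * (r : ℂ) * (Z1 + Z2) + 2 * Z_C ≠ 0)
    (h3 : 1 / (2 * (r : ℂ) * Z2 + Z_L) + 1 / (2 * (r : ℂ) * (Z1 + Z2) + 2 * Z_C) ≠ 0)
    (heq1 : Z1 + (1 / 2) * Z2 = Z_L + (r : ℂ) * Z1 +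
      (1 / 2) * ((r : ℂ) * Z1 + 2 * (r : ℂ) * Z2 + 2 * Z_C))
    (heq2 : 2 * Z2 = 2 * (r : ℂ) * Z2 + 2 * Z_C +
      (1 / (2 * (r : ℂ) * Z2 + Z_L) + 1 / (2 * (r : ℂ) * (Z1 + Z2) + 2 * Z_C))⁻¹) :
    Z1 = ((2 * (r : ℂ) - 1) * Z2 + 2 * (Z_C + Z_L)) / (2 - 3 * (r : ℂ)) ∧
    2 * (r : ℂ) * (1 - (r : ℂ)) * (5 * (r : ℂ) - 3) * Z2 ^ 2 +
      2 * (2 * (1 - (r : ℂ)) * (3 * (r : ℂ) - 1) * Z_C +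
        (2 * (r : ℂ) - 1) * ((r : ℂ) + 1) * Z_L) * Z2 +
      2 * (Z_L + Z_C) * ((2 - (r : ℂ)) * Z_C + (r : ℂ) * Z_L) = 0 := by
  have hk : (2 : ℂ) - 3 * r ≠ 0 := by
    intro h
    have h' : (2 : ℝ) - 3 * r = 0 := by exact_mod_cast h
    exact hr (by linarith)
  have hZ1 : (2 - 3 * (r : ℂ)) * Z1 = (2 * (r : ℂ) - 1) * Z2 + 2 * (Z_C + Z_L) := by
    linear_combination 2 * heq1
  refine ⟨by rw [eq_div_iff hk, mul_comm, hZ1], ?_⟩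
  have hX : (2 * Z2 - 2 * (r : ℂ) * Z2 - 2 * Z_C) *
      ((2 * (r : ℂ) * Z2 + Z_L) + (2 * (r : ℂ) * (Z1 + Z2) + 2 * Z_C)) =
      (2 * (r : ℂ) * Z2 + Z_L) * (2 * (r : ℂ) * (Z1 + Z2) + 2 * Z_C) := by
    have hinv : (2 * Z2 - 2 * (r : ℂ) * Z2 - 2 * Z_C) *
        (1 / (2 * (r : ℂ) * Z2 + Z_L) + 1 / (2 * (r : ℂ) * (Z1 + Z2) + 2 * Z_C)) = 1 := by
      rw [mul_eq_one_iff_eq_inv₀ h3]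
      linear_combination heq2
    rw [div_add_div _ _ h1 h2, ← mul_div_assoc, div_eq_iff (mul_ne_zero h1 h2)] at hinv
    linear_combination hinv
  linear_combination (-(2 - 3 * (r : ℂ)) / 2) * hX +
    (r : ℂ) * (2 * Z2 - 2 * (r : ℂ) * Z2 - 2 * Z_C - (2 * (r : ℂ) * Z2 + Z_L)) * hZ1
end

section
/- Let Z_1, Z_2, Z_C, Z_L be complex numbers, set r = 2/3, and assume 2rZ_2 + Z_L ≠ 0, 2r(Z_1 + Z_2) + 2Z_C ≠ 0, 1/(2rZ_2 + Z_L) + 1/(2r(Z_1+Z_2) + 2Z_C) ≠ 0, and 2Z_C + 3Z_L ≠ 0. If Z_1 + (1/2)Z_2 = Z_L + rZ_1 + (1/2)(rZ_1 + 2rZ_2 + 2Z_C) and 2Z_2 = 2rZ_2 + 2Z_C + (1/(2rZ_2 + Z_L) + 1/(2r(Z_1+Z_2) + 2Z_C))⁻¹, then Z_2 = −6(Z_C + Z_L) and Z_1 = −3(Z_C + Z_L)(9Z_C + Z_L)/(2Z_C + 3Z_L); in particular, if Re(Z_C) = Re(Z_L) = 0, then both Z_1 and Z_2 are purely imaginary.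 -/
/-- Hanoi II circuit, exceptional scaling `r = 2/3`: the Kirchhoff
self-consistency equations force `Z₂ = −6(Z_C+Z_L)` and
`Z₁ = −3(Z_C+Z_L)(9Z_C+Z_L)/(2Z_C+3Z_L)`; in particular both are purely
imaginary when `Z_C` and `Z_L` are. -/
theorem hanoi2_equations_r_two_thirds (Z1 Z2 Z_C Z_L : ℂ) (r : ℝ) (hr : r = 2 / 3)
    (h1 : 2 * (r : ℂ) * Z2 + Z_L ≠ 0)
    (h2 : 2 * (r : ℂ) * (Z1 + Z2) + 2 * Z_C ≠ 0)
    (h3 : 1 / (2 * (r : ℂ) * Z2 + Z_L) + 1 / (2 * (r : ℂ) * (Z1 + Z2) + 2 * Z_C) ≠ 0)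
    (h4 : 2 * Z_C + 3 * Z_L ≠ 0)
    (heq1 : Z1 + (1 / 2) * Z2 = Z_L + (r : ℂ) * Z1 +
      (1 / 2) * ((r : ℂ) * Z1 + 2 * (r : ℂ) * Z2 + 2 * Z_C))
    (heq2 : 2 * Z2 = 2 * (r : ℂ) * Z2 + 2 * Z_C +
      (1 / (2 * (r : ℂ) * Z2 + Z_L) + 1 / (2 * (r : ℂ) * (Z1 + Z2) + 2 * Z_C))⁻¹) :
    Z2 = -6 * (Z_C + Z_L) ∧
    Z1 = -3 * (Z_C + Z_L) * (9 * Z_C + Z_L) / (2 * Z_C + 3 * Z_L) ∧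
    (Z_C.re = 0 → Z_L.re = 0 → Z1.re = 0 ∧ Z2.re = 0) := by
  subst hr
  push_cast at *
  have hZ2 : Z2 = -6 * (Z_C + Z_L) := by linear_combination (-6) * heq1
  have hpar : (2 / 3 * Z2 - 2 * Z_C) *
      (1 / (2 * (2 / 3) * Z2 + Z_L) + 1 / (2 * (2 / 3) * (Z1 + Z2) + 2 * Z_C)) = 1 := by
    have hW : 2 / 3 * Z2 - 2 * Z_C =
        (1 / (2 * (2 / 3) * Z2 + Z_L) + 1 / (2 * (2 / 3) * (Z1 + Z2) + 2 * Z_C))⁻¹ := by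
      linear_combination heq2
    rw [hW, inv_mul_cancel₀ h3]
  have hZ1 : Z1 = -3 * (Z_C + Z_L) * (9 * Z_C + Z_L) / (2 * Z_C + 3 * Z_L) := by
    have hprod : ∀ A B W : ℂ, A ≠ 0 → B ≠ 0 → W * (1 / A + 1 / B) = 1 →
        W * (A + B) = A * B := by
      intro A B W hA hB h
      field_simp at h
      linear_combination h
    have key := hprod _ _ _ h1 h2 hpar
    rw [hZ2] at key
    rw [eq_div_iff h4]
    linear_combination (3 / 4) * key
  refine ⟨hZ2, hZ1, fun hC hL => ⟨?_, by simp [hZ2, hC, hL]⟩⟩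
  have hC' : Z_C = (Z_C.im : ℂ) * Complex.I := by apply Complex.ext <;> simp [hC]
  have hL' : Z_L = (Z_L.im : ℂ) * Complex.I := by apply Complex.ext <;> simp [hL]
  generalize Z_C.im = c at hC'
  generalize Z_L.im = l at hL'
  have hZ1' : Z1 = ((-3 * (c + l) * (9 * c + l) / (2 * c + 3 * l) : ℝ) : ℂ) * Complex.I := by
    rw [hC', hL'] at h4
    have hd : (2 * (c : ℂ) + 3 * l) ≠ 0 := by
      rintro h
      exact h4 (by linear_combination Complex.I * h)
    rw [hZ1, hC', hL', div_eq_iff h4]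
    push_cast
    rw [div_mul_eq_mul_div, div_mul_eq_mul_div, eq_div_iff hd]
    ring
  simp only [hZ1', Complex.re_ofReal_mul, Complex.I_re, mul_zero]
end

section
/- Let r be a real number with 0 < r < 3/5, let ω, L, C be positive reals, and set Z_C = 1/(iωC), Z_L = iωL, and Ω = ω²LC. Then there exists a complex number Z_2 with Re(Z_2) > 0 satisfying 2r(1−r)(5r−3)·Z_2² + 2·(2(1−r)(3r−1)·Z_C + (2r−1)(r+1)·Z_L)·Z_2 + 2(Z_L + Z_C)·((2−r)Z_C + rZ_L) = 0 if and only if (−24r⁴ + 28r³ − 9r² + 2r − 1)·Ω² − 4(r−1)²(6r² − 3r − 1)·Ω + 4(1−r)(4r³ − 2r² + r − 1) > 0. -/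
/-- A quadratic whose outer coefficients are real and whose middle coefficient is purely imaginary
has a root in the open right half-plane iff `b ^ 2 + a * c < 0`. -/
theorem exists_re_pos_quadratic_iff (a b c : ℝ) (ha : a ≠ 0) :
    (∃ z : ℂ, 0 < z.re ∧ (a : ℂ) * z ^ 2 + 2 * (Complex.I * b) * z + c = 0) ↔
      b ^ 2 + a * c < 0 := by
  constructor
  · rintro ⟨z, hz, h⟩
    have hre : a * (z.re ^ 2 - z.im ^ 2) - 2 * b * z.im + c = 0 := by
      have := congrArg Complex.re h
      simp [pow_two] at this
      linarith
    have him : a * z.im + b = 0 := by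
      have := congrArg Complex.im h
      simp [pow_two] at this
      have h' : z.re * (a * z.im + b) = 0 := by linarith
      exact (mul_eq_zero.mp h').resolve_left hz.ne'
    have key : b ^ 2 + a * c = -(a * z.re) ^ 2 := by
      linear_combination a * hre + (a * z.im + b) * him
    rw [key]
    have : a * z.re ≠ 0 := mul_ne_zero ha hz.ne'
    have := sq_pos_of_ne_zero this
    linarith
  · intro h
    have hsq : 0 < -(b ^ 2 + a * c) / a ^ 2 := div_pos (by linarith) (by positivity)
    set u := √(-(b ^ 2 + a * c) / a ^ 2) with hu
    have hu2 : u ^ 2 = -(b ^ 2 + a * c) / a ^ 2 := Real.sq_sqrt hsq.le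
    refine ⟨⟨u, -b / a⟩, Real.sqrt_pos.mpr hsq, ?_⟩
    apply Complex.ext
    · have : a * (u ^ 2 - (-b / a) ^ 2) - 2 * b * (-b / a) + c = 0 := by
        rw [hu2]
        field_simp
        ring
      simp [pow_two] at this ⊢
      linarith
    · have : a * (-b / a) + b = 0 := by
        field_simp
        ring
      simp [pow_two] at this ⊢
      linear_combination 2 * u * this


/-- Hanoi II circuit filter condition: for `0 < r < 3/5`, there is a root `Z₂`
of the characteristic quadratic with positive real part iff the displayed
polynomial inequality in `Ω = ω²LC` holds. -/
theorem hanoi2_filter_condition (r : ℝ) (hr0 : 0 < r) (hr1 : r < 3 / 5)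
    (ω L C : ℝ) (hω : 0 < ω) (hL : 0 < L) (hC : 0 < C)
    (Z_C Z_L : ℂ) (Ω : ℝ)
    (hZC : Z_C = 1 / (Complex.I * (ω : ℂ) * (C : ℂ)))
    (hZL : Z_L = Complex.I * (ω : ℂ) * (L : ℂ))
    (hΩ : Ω = ω ^ 2 * L * C) :
    (∃ Z2 : ℂ, 0 < Z2.re ∧
      2 * (r : ℂ) * (1 - (r : ℂ)) * (5 * (r : ℂ) - 3) * Z2 ^ 2 +
        2 * (2 * (1 - (r : ℂ)) * (3 * (r : ℂ) - 1) * Z_C +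
          (2 * (r : ℂ) - 1) * ((r : ℂ) + 1) * Z_L) * Z2 +
        2 * (Z_L + Z_C) * ((2 - (r : ℂ)) * Z_C + (r : ℂ) * Z_L) = 0) ↔
    0 < (-24 * r ^ 4 + 28 * r ^ 3 - 9 * r ^ 2 + 2 * r - 1) * Ω ^ 2 -
        4 * (r - 1) ^ 2 * (6 * r ^ 2 - 3 * r - 1) * Ω +
        4 * (1 - r) * (4 * r ^ 3 - 2 * r ^ 2 + r - 1) := by
  have hden : 0 < ω * C := mul_pos hω hC
  have hC0 : (C : ℂ) ≠ 0 := by exact_mod_cast hC.ne'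
  have hω0 : (ω : ℂ) ≠ 0 := by exact_mod_cast hω.ne'
  set y : ℝ := 1 / (ω * C) with hy
  have hy0 : 0 < y := by positivity
  have hZC' : Z_C = -(Complex.I * (y : ℂ)) := by
    rw [hZC, hy]
    push_cast
    field_simp
    simp
  have hΩy : ω * L = Ω * y := by
    rw [hΩ, hy]
    field_simp
  have hZL' : Z_L = Complex.I * ((Ω : ℂ) * y) := by
    rw [hZL, mul_assoc]
    exact_mod_cast congrArg (fun t : ℝ => Complex.I * (t : ℂ)) hΩy
  have ha : 2 * r * (1 - r) * (5 * r - 3) ≠ 0 :=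
    mul_ne_zero (mul_ne_zero (by linarith) (by linarith)) (by linarith)
  have hroot := exists_re_pos_quadratic_iff (2 * r * (1 - r) * (5 * r - 3))
    (((2 * r - 1) * (r + 1) * Ω - 2 * (1 - r) * (3 * r - 1)) * y)
    (-2 * (Ω - 1) * (r * Ω - (2 - r)) * y ^ 2) ha
  refine Iff.trans (exists_congr fun z => and_congr_right fun _ => ?_) (hroot.trans ?_)
  · rw [hZC', hZL']
    push_cast
    refine Eq.congr ?_ rfl
    linear_combination
      (2 * ((Ω : ℂ) - 1) * (r * Ω - (2 - r)) * (y : ℂ) ^ 2) * Complex.I_sq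
  · have hpoly : (((2 * r - 1) * (r + 1) * Ω - 2 * (1 - r) * (3 * r - 1)) * y) ^ 2 +
        2 * r * (1 - r) * (5 * r - 3) * (-2 * (Ω - 1) * (r * Ω - (2 - r)) * y ^ 2) =
        -(y ^ 2 * ((-24 * r ^ 4 + 28 * r ^ 3 - 9 * r ^ 2 + 2 * r - 1) * Ω ^ 2 -
          4 * (r - 1) ^ 2 * (6 * r ^ 2 - 3 * r - 1) * Ω +
          4 * (1 - r) * (4 * r ^ 3 - 2 * r ^ 2 + r - 1))) := by
      ring
    rw [hpoly, neg_lt_zero, mul_pos_iff_of_pos_left (by positivity)]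
end

section
/- For a real number r with 0 < r < 2/3, define P(r, Ω) = (−24r⁴ + 28r³ − 9r² + 2r − 1)·Ω² − 4(r−1)²(6r² − 3r − 1)·Ω + 4(1−r)(4r³ − 2r² + r − 1). Then there exists Ω > 0 with P(r, Ω) > 0 if and only if r < 3/5 and r ≠ 1/2; moreover, if 0 < r < 3/5 and r ≠ 1/2, then P(r, 2) > 0 (i.e. Ω = 2 lies in the filter range). -/
/-- The leading coefficient of the Hanoi II filter polynomial is negative. -/
theorem hanoi2_leadingCoeff_neg (r : ℝ) :
    -24 * r ^ 4 + 28 * r ^ 3 - 9 * r ^ 2 + 2 * r - 1 < 0 := by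
  nlinarith [sq_nonneg (r ^ 2 - 7 / 12 * r - 1 / 32), sq_nonneg (r - 8 / 13)]

/-- Hanoi II filter polynomial: for `0 < r < 2/3`, there is a frequency
`Ω > 0` with `P(r, Ω) > 0` iff `r < 3/5` and `r ≠ 1/2`; moreover in that case
`Ω = 2` always lies in the filter range. -/
theorem hanoi2_filter_scalings (r : ℝ) (hr0 : 0 < r) (hr1 : r < 2 / 3)
    (P : ℝ → ℝ)
    (hP : ∀ Ω : ℝ, P Ω = (-24 * r ^ 4 + 28 * r ^ 3 - 9 * r ^ 2 + 2 * r - 1) * Ω ^ 2 -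
      4 * (r - 1) ^ 2 * (6 * r ^ 2 - 3 * r - 1) * Ω +
      4 * (1 - r) * (4 * r ^ 3 - 2 * r ^ 2 + r - 1)) :
    ((∃ Ω : ℝ, 0 < Ω ∧ 0 < P Ω) ↔ (r < 3 / 5 ∧ r ≠ 1 / 2)) ∧
    (r < 3 / 5 → r ≠ 1 / 2 → 0 < P 2) := by
  have h_two : P 2 = 8 * r * (2 * r - 1) ^ 2 * (3 - 5 * r) := by
    rw [hP]
    ring
  have h_pos : r < 3 / 5 → r ≠ 1 / 2 → 0 < P 2 := by
    intro h h'
    have h1 : 2 * r - 1 ≠ 0 := fun h0 => h' (by linarith)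
    have h2 : 0 < 3 - 5 * r := by linarith
    rw [h_two]
    positivity
  refine ⟨⟨?_, fun h => ⟨2, two_pos, h_pos h.1 h.2⟩⟩, h_pos⟩
  rintro ⟨Ω, -, hΩ⟩
  have h_lead := hanoi2_leadingCoeff_neg r
  have h_square : (-24 * r ^ 4 + 28 * r ^ 3 - 9 * r ^ 2 + 2 * r - 1) * P Ω =
      ((-24 * r ^ 4 + 28 * r ^ 3 - 9 * r ^ 2 + 2 * r - 1) * Ω -
        2 * ((r - 1) ^ 2 * (6 * r ^ 2 - 3 * r - 1))) ^ 2 -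
      4 * (r * (1 - r) * (r + 1) ^ 2 * (2 - 3 * r)) * ((2 * r - 1) ^ 2 * (3 - 5 * r)) := by
    rw [hP]
    ring
  have h_factor : 0 < 4 * (r * (1 - r) * (r + 1) ^ 2 * (2 - 3 * r)) := by
    have h1 : 0 < 1 - r := by linarith
    have h2 : 0 < 2 - 3 * r := by linarith
    positivity
  have h_disc : 0 < (2 * r - 1) ^ 2 * (3 - 5 * r) := by
    refine pos_of_mul_pos_right ?_ h_factor.le
    nlinarith [mul_neg_of_neg_of_pos h_lead hΩ, sq_nonneg
      ((-24 * r ^ 4 + 28 * r ^ 3 - 9 * r ^ 2 + 2 * r - 1) * Ω -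
        2 * ((r - 1) ^ 2 * (6 * r ^ 2 - 3 * r - 1)))]
  constructor
  · linarith [pos_of_mul_pos_right h_disc (sq_nonneg (2 * r - 1))]
  · rintro rfl
    norm_num at h_disc
end
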